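/- arXiv:1910.02026 — 9 statements merged into one kernel-verified Lean document; each statement's English description precedes it below -/
import Mathlib

section
/- Let (x,y) ∈ Sⁿ × Sⁿ with (x,y) ≠ (r,r). Then the squared norm of the tangential projection of the gradient satisfies ‖Π(x)∇V^y(x)‖² = 2k·V(x,y)·(1 − V(x,y))·(1 − rᵀy) / (1 − rᵀx + k(1 − yᵀx))². -/
open scoped RealInnerProductSpace

/-- The synergistic potential function `V(x,y) = (1 - ⟪r,x⟫)/((1 - ⟪r,x⟫) + k(1 - ⟪y,x⟫))`. -/
noncomputable def synV {n : ℕ} (k : ℝ) (r x y : EuclideanSpace ℝ (Fin (n + 1))) : ℝ :=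
  (1 - ⟪r, x⟫) / ((1 - ⟪r, x⟫) + k * (1 - ⟪y, x⟫))

/-- The gradient at `x` of the map `x ↦ V(x,y)` for fixed `y`. -/
noncomputable def gradVy {n : ℕ} (k : ℝ) (r y x : EuclideanSpace ℝ (Fin (n + 1))) :
    EuclideanSpace ℝ (Fin (n + 1)) :=
  gradient (fun z => (1 - ⟪r, z⟫) / ((1 - ⟪r, z⟫) + k * (1 - ⟪y, z⟫))) x

/-- `Π(x)w = w - (xᵀw) x`, the orthogonal projection onto the tangent space to `Sⁿ` at `x`
(for `‖x‖ = 1` this is `(I - x xᵀ) w`). -/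
noncomputable def tangProj {n : ℕ} (x w : EuclideanSpace ℝ (Fin (n + 1))) :
    EuclideanSpace ℝ (Fin (n + 1)) :=
  w - ⟪x, w⟫ • x

theorem stmt1 (n : ℕ) (hn : 1 ≤ n) (k : ℝ) (hk : 0 < k)
    (r : EuclideanSpace ℝ (Fin (n + 1))) (hr : ‖r‖ = 1)
    (x y : EuclideanSpace ℝ (Fin (n + 1))) (hx : ‖x‖ = 1) (hy : ‖y‖ = 1)
    (hxy : (x, y) ≠ (r, r)) :
    ‖tangProj x (gradVy k r y x)‖ ^ 2 =
      2 * k * synV k r x y * (1 - synV k r x y) * (1 - ⟪r, y⟫) /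
        ((1 - ⟪r, x⟫) + k * (1 - ⟪y, x⟫)) ^ 2 := by
  have ha1 : ⟪r, x⟫ ≤ 1 := by simpa [hr, hx] using real_inner_le_norm r x
  have hb1 : ⟪y, x⟫ ≤ 1 := by simpa [hy, hx] using real_inner_le_norm y x
  have hD : (1 - ⟪r, x⟫) + k * (1 - ⟪y, x⟫) ≠ 0 := by
    intro h
    have h1 : 0 ≤ k * (1 - ⟪y, x⟫) := mul_nonneg hk.le (by linarith)
    have h2 : ⟪r, x⟫ = 1 := by linarith
    have h3 : k * (1 - ⟪y, x⟫) = 0 := by linarith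
    have h4 : ⟪y, x⟫ = 1 := by
      rcases mul_eq_zero.mp h3 with h | h <;> linarith
    have h5 := (inner_eq_one_iff_of_norm_eq_one hr hx).mp h2
    have h6 := (inner_eq_one_iff_of_norm_eq_one hy hx).mp h4
    apply hxy
    rw [h6, h5]
  have hA : HasFDerivAt (fun z => 1 - ⟪r, z⟫) (-(innerSL ℝ r)) x :=
    ((innerSL ℝ r).hasFDerivAt (x := x)).const_sub 1
  have hB : HasFDerivAt (fun z => 1 - ⟪y, z⟫) (-(innerSL ℝ y)) x :=
    ((innerSL ℝ y).hasFDerivAt (x := x)).const_sub 1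
  have hg : gradVy k r y x = (((1 - ⟪r, x⟫) + k * (1 - ⟪y, x⟫)) ^ 2)⁻¹ •
      ((k * (1 - ⟪r, x⟫)) • y - (k * (1 - ⟪y, x⟫)) • r) := by
    apply HasGradientAt.gradient
    rw [hasGradientAt_iff_hasFDerivAt]
    have hI := (hasDerivAt_inv hD).comp_hasFDerivAt x (hA.add (hB.const_mul k))
    have hM := hA.mul hI
    refine HasFDerivAt.congr_fderiv (f := fun z =>
      (1 - ⟪r, z⟫) / ((1 - ⟪r, z⟫) + k * (1 - ⟪y, z⟫))) hM ?_
    ext v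
    simp [inner_sub_left, inner_smul_left]
    field_simp
    ring
  have hxx : ⟪x, x⟫ = 1 := by simp [hx]
  have hrr : ⟪r, r⟫ = 1 := by simp [hr]
  have hyy : ⟪y, y⟫ = 1 := by simp [hy]
  rw [hg, tangProj, synV, ← real_inner_self_eq_norm_sq]
  simp only [inner_sub_left, inner_sub_right, real_inner_smul_left, real_inner_smul_right,
    hxx, hrr, hyy, real_inner_comm r x, real_inner_comm y x, real_inner_comm r y]
  rw [real_inner_comm x r, real_inner_comm x y] at *
  generalize ⟪x, r⟫ = a at *
  generalize ⟪x, y⟫ = b at *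
  generalize ⟪y, r⟫ = c at *
  field_simp
  ring
end

section
/- Fix y ∈ Sⁿ. If y ≠ r, then the set of critical points {x ∈ Sⁿ : (x,y) ≠ (r,r) and Π(x)∇V^y(x) = 0} equals {r, y}. If y = r, then Π(x)∇V^y(x) = 0 for every x ∈ Sⁿ \ {r} (indeed V(x,r) = 1/(1+k) is constant in x). -/
open scoped RealInnerProductSpace

theorem aux_grad {n : ℕ} (k : ℝ) (r y x : EuclideanSpace ℝ (Fin (n + 1)))
    (hD : (1 - ⟪r, x⟫) + k * (1 - ⟪y, x⟫) ≠ 0) :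
    gradVy k r y x = (k / ((1 - ⟪r, x⟫) + k * (1 - ⟪y, x⟫)) ^ 2) •
      ((1 - ⟪r, x⟫) • y - (1 - ⟪y, x⟫) • r) := by
  unfold gradVy
  apply HasGradientAt.gradient
  rw [hasGradientAt_iff_hasFDerivAt]
  have h1 : ∀ a : EuclideanSpace ℝ (Fin (n + 1)),
      HasFDerivAt (fun z => 1 - ⟪a, z⟫) (-(innerSL ℝ a)) x := fun a =>
    ((innerSL ℝ a).hasFDerivAt (x := x)).const_sub 1
  have h2 := (h1 r).add ((h1 y).const_mul k)
  have h3 := (h1 r).mul ((hasDerivAt_inv hD).comp_hasFDerivAt x h2)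
  refine h3.congr_fderiv ?_
  ext v
  simp [inner_sub_left, inner_smul_left]
  field_simp
  ring

theorem aux_norm {n : ℕ} {a x : EuclideanSpace ℝ (Fin (n + 1))} (ha : ‖a‖ = 1) (hx : ‖x‖ = 1) :
    ‖a - x‖ ^ 2 = 2 * (1 - ⟪a, x⟫) := by
  rw [norm_sub_sq_real, ha, hx]; ring

theorem aux_lt {n : ℕ} {a x : EuclideanSpace ℝ (Fin (n + 1))} (ha : ‖a‖ = 1) (hx : ‖x‖ = 1)
    (h : a ≠ x) : 0 < 1 - ⟪a, x⟫ := by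
  have h1 := aux_norm ha hx
  have h2 : 0 < ‖a - x‖ := norm_pos_iff.2 (sub_ne_zero.2 h)
  have h3 : 0 < ‖a - x‖ ^ 2 := by positivity
  linarith

theorem stmt5 (n : ℕ) (hn : 1 ≤ n) (k : ℝ) (hk : 0 < k)
    (r : EuclideanSpace ℝ (Fin (n + 1))) (hr : ‖r‖ = 1)
    (y : EuclideanSpace ℝ (Fin (n + 1))) (hy : ‖y‖ = 1) :
    (y ≠ r →
      {x : EuclideanSpace ℝ (Fin (n + 1)) |
          ‖x‖ = 1 ∧ (x, y) ≠ (r, r) ∧ tangProj x (gradVy k r y x) = 0} = {r, y}) ∧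
    (y = r → ∀ x : EuclideanSpace ℝ (Fin (n + 1)), ‖x‖ = 1 → x ≠ r →
      tangProj x (gradVy k r y x) = 0 ∧ synV k r x y = 1 / (1 + k)) := by
  have self1 : ∀ a : EuclideanSpace ℝ (Fin (n + 1)), ‖a‖ = 1 → ⟪a, a⟫ = 1 := by
    intro a ha
    rw [real_inner_self_eq_norm_sq, ha]; norm_num
  constructor
  · intro hyr
    ext x
    simp only [Set.mem_setOf_eq, Set.mem_insert_iff, Set.mem_singleton_iff]
    constructor
    · rintro ⟨hx, -, hc⟩
      by_contra hne
      push Not at hne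
      obtain ⟨hxr, hxy⟩ := hne
      have hf := aux_lt hr hx (Ne.symm hxr)
      have hg := aux_lt hy hx (Ne.symm hxy)
      have hD : 0 < (1 - ⟪r, x⟫) + k * (1 - ⟪y, x⟫) := by positivity
      rw [aux_grad k r y x hD.ne'] at hc
      have hnr := aux_norm hr hx
      have hny := aux_norm hy hx
      have hcoef : k / ((1 - ⟪r, x⟫) + k * (1 - ⟪y, x⟫)) ^ 2 ≠ 0 := by positivity
      generalize k / ((1 - ⟪r, x⟫) + k * (1 - ⟪y, x⟫)) ^ 2 = c at hc hcoef
      have e : (1 - ⟪r, x⟫) • (y - x) = (1 - ⟪y, x⟫) • (r - x) := by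
        have : c • ((1 - ⟪r, x⟫) • (y - x) - (1 - ⟪y, x⟫) • (r - x)) = 0 := by
          rw [← hc]
          simp only [tangProj, inner_smul_right, inner_sub_right, real_inner_comm x]
          rw [real_inner_comm r x, real_inner_comm y x]
          module
        exact sub_eq_zero.1 ((smul_eq_zero.1 this).resolve_left hcoef)
      have e2 := congrArg (fun v => ‖v‖ ^ 2) e
      simp only [norm_smul, mul_pow, hnr, hny, Real.norm_eq_abs, sq_abs] at e2
      have hfg : 1 - ⟪r, x⟫ = 1 - ⟪y, x⟫ := by
        have : ((1 - ⟪r, x⟫) * (1 - ⟪y, x⟫)) * ((1 - ⟪r, x⟫) - (1 - ⟪y, x⟫)) = 0 := by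
          linarith
        have := (mul_eq_zero.1 this).resolve_left (by positivity)
        linarith
      rw [← hfg] at e
      exact hyr (sub_left_injective (smul_right_injective _ hf.ne' e))
    · rintro (rfl | rfl)
      · refine ⟨hr, fun h => hyr (Prod.ext_iff.1 h).2, ?_⟩
        have hg := aux_lt hy hr hyr
        rw [aux_grad]
        · simp only [tangProj, inner_smul_right, inner_sub_right, self1 _ hr]
          module
        · rw [self1 _ hr]; positivity
      · refine ⟨hy, fun h => hyr (Prod.ext_iff.1 h).2, ?_⟩
        have hf := aux_lt hr hy hyr.symm
        rw [aux_grad]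
        · simp only [tangProj, inner_smul_right, inner_sub_right, self1 _ hy]
          module
        · rw [self1 _ hy]; simpa using hf.ne'
  · rintro rfl x hx hxr
    have hf := aux_lt hr hx hxr.symm
    constructor
    · rw [aux_grad]
      · simp [tangProj]
      · positivity
    · unfold synV
      field_simp
end

section
/- Let x ∈ Sⁿ with x ≠ r and x ≠ −r, and set v := rᵀx. Then the minimum of yᵀx over the set {y ∈ Sⁿ : rᵀy = γ} equals α(v) = γv − √((1 − v²)(1 − γ²)), and it is attained at y* := α(v)·x + σ(v)·Π(x)r/‖Π(x)r‖, where σ(v) = γ√(1 − v²) + v√(1 − γ²). -/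
open scoped RealInnerProductSpace

theorem stmt6 (n : ℕ) (hn : 1 ≤ n) (γ : ℝ) (hγ : -1 < γ ∧ γ < 1)
    (r : EuclideanSpace ℝ (Fin (n + 1))) (hr : ‖r‖ = 1)
    (x : EuclideanSpace ℝ (Fin (n + 1))) (hx : ‖x‖ = 1)
    (hxr : x ≠ r) (hxr' : x ≠ -r)
    (v : ℝ) (hv : v = ⟪r, x⟫)
    (α σ : ℝ → ℝ)
    (hα : ∀ w : ℝ, α w = γ * w - Real.sqrt ((1 - w ^ 2) * (1 - γ ^ 2)))
    (hσ : ∀ w : ℝ, σ w = γ * Real.sqrt (1 - w ^ 2) + w * Real.sqrt (1 - γ ^ 2))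
    (ystar : EuclideanSpace ℝ (Fin (n + 1)))
    (hystar : ystar = α v • x + σ v • (‖tangProj x r‖⁻¹ • tangProj x r)) :
    IsLeast {w : ℝ | ∃ y : EuclideanSpace ℝ (Fin (n + 1)),
        ‖y‖ = 1 ∧ ⟪r, y⟫ = γ ∧ w = ⟪y, x⟫} (α v) ∧
    ‖ystar‖ = 1 ∧ ⟪r, ystar⟫ = γ ∧ ⟪ystar, x⟫ = α v := by
  have hxx : ⟪x, x⟫ = 1 := by rw [real_inner_self_eq_norm_sq, hx]; norm_num
  have hrr : ⟪r, r⟫ = 1 := by rw [real_inner_self_eq_norm_sq, hr]; norm_num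
  have hrx : ⟪r, x⟫ = v := hv.symm
  have hxr0 : ⟪x, r⟫ = v := by rw [real_inner_comm]; exact hrx
  have h1 : v < 1 := by
    have h : 0 < ‖x - r‖ ^ 2 := by
      have := norm_pos_iff.2 (sub_ne_zero.2 hxr)
      positivity
    rw [norm_sub_sq_real, hx, hr, hxr0] at h
    linarith
  have h2 : -1 < v := by
    have h : 0 < ‖x + r‖ ^ 2 := by
      have : x + r ≠ 0 := fun h => hxr' (eq_neg_of_add_eq_zero_left h)
      have := norm_pos_iff.2 this
      positivity
    rw [norm_add_sq_real, hx, hr, hxr0] at h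
    linarith
  have hv1 : 0 < 1 - v ^ 2 := by nlinarith
  have hg1 : 0 < 1 - γ ^ 2 := by nlinarith [hγ.1, hγ.2]
  obtain ⟨s, hs⟩ : ∃ s, s = Real.sqrt (1 - v ^ 2) := ⟨_, rfl⟩
  obtain ⟨c, hc⟩ : ∃ c, c = Real.sqrt (1 - γ ^ 2) := ⟨_, rfl⟩
  have hs0 : 0 < s := hs ▸ Real.sqrt_pos.2 hv1
  have hc0 : 0 < c := hc ▸ Real.sqrt_pos.2 hg1
  have hs2 : s ^ 2 = 1 - v ^ 2 := by rw [hs, Real.sq_sqrt hv1.le]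
  have hc2 : c ^ 2 = 1 - γ ^ 2 := by rw [hc, Real.sq_sqrt hg1.le]
  have ha : α v = γ * v - s * c := by rw [hα, Real.sqrt_mul hv1.le, hs, hc]
  have hsg : σ v = γ * s + v * c := by rw [hσ, hs, hc]
  have hT : ‖tangProj x r‖ = s := by
    rw [hs, eq_comm, Real.sqrt_eq_iff_eq_sq hv1.le (norm_nonneg _),
      ← real_inner_self_eq_norm_sq]
    simp only [tangProj, inner_sub_left, inner_sub_right, inner_smul_left, inner_smul_right,
      hxx, hrr, hrx, hxr0, conj_trivial]
    ring
  have hTx : ⟪tangProj x r, x⟫ = 0 := by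
    simp only [tangProj, inner_sub_left, inner_smul_left, hxx, hrx, hxr0, conj_trivial]
    ring
  have hxT : ⟪x, tangProj x r⟫ = 0 := by rw [real_inner_comm]; exact hTx
  have hTT : ⟪tangProj x r, tangProj x r⟫ = s ^ 2 := by
    rw [real_inner_self_eq_norm_sq, hT]
  have hrT : ⟪r, tangProj x r⟫ = s ^ 2 := by
    simp only [tangProj, inner_sub_right, inner_smul_right, hrr, hrx, hxr0]
    rw [hs2]; ring
  rw [hT] at hystar
  have e1 : ‖ystar‖ = 1 := by
    have : ‖ystar‖ ^ 2 = 1 := by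
      rw [← real_inner_self_eq_norm_sq, hystar]
      simp only [inner_add_left, inner_add_right, inner_smul_left, inner_smul_right,
        hxx, hTx, hxT, hTT, conj_trivial]
      rw [ha, hsg]
      field_simp
      linear_combination s * ((γ ^ 2 + c ^ 2) * hs2 + hc2)
    exact (pow_eq_one_iff_of_nonneg (norm_nonneg _) two_ne_zero).1 this
  have e2 : ⟪r, ystar⟫ = γ := by
    rw [hystar]
    simp only [inner_add_right, inner_smul_right, hrx, hrT]
    rw [ha, hsg]
    field_simp
    linear_combination γ * hs2
  have e3 : ⟪ystar, x⟫ = α v := by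
    rw [hystar]
    simp only [inner_add_left, inner_smul_left, hxx, hTx, conj_trivial]
    ring
  refine ⟨⟨⟨ystar, e1, e2, e3.symm⟩, ?_⟩, e1, e2, e3⟩
  rintro w ⟨y, hy, hry, rfl⟩
  have hyr : ⟪y, r⟫ = γ := by rw [real_inner_comm]; exact hry
  have n1 : ‖y - γ • r‖ = c := by
    rw [hc, eq_comm, Real.sqrt_eq_iff_eq_sq hg1.le (norm_nonneg _), norm_sub_sq_real,
      norm_smul, inner_smul_right, hyr, hy, hr, Real.norm_eq_abs, mul_one, sq_abs]
    ring
  have n2 : ‖x - v • r‖ = s := by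
    rw [hs, eq_comm, Real.sqrt_eq_iff_eq_sq hv1.le (norm_nonneg _), norm_sub_sq_real,
      norm_smul, inner_smul_right, hxr0, hx, hr, Real.norm_eq_abs, mul_one, sq_abs]
    ring
  have h := (abs_le.1 (abs_real_inner_le_norm (y - γ • r) (x - v • r))).1
  rw [n1, n2] at h
  simp only [inner_sub_left, inner_sub_right, inner_smul_left, inner_smul_right,
    hrr, hrx, hyr, conj_trivial] at h
  rw [ha]
  linarith
end

section
/- For every x ∈ Sⁿ, the minimum m_V(x) := min_{y ∈ Y} V(x,y) is given by: m_V(x) = (1 − rᵀx)/(1 − rᵀx + 2k) if rᵀx ≥ −γ, and m_V(x) = (1 − rᵀx)/(1 − rᵀx + k(1 − α(rᵀx))) if rᵀx < −γ. Moreover, the set of minimizers argmin_{y ∈ Y} V(x,y) equals: all of Y if x = r; {−x} if rᵀx ≥ −γ and x ≠ r; {σ(rᵀx)·Π(x)r/‖Π(x)r‖ + α(rᵀx)·x} if −1 < rᵀx < −γ; and {y ∈ Sⁿ : rᵀy = γ} if rᵀx = −1. -/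
open scoped RealInnerProductSpace

lemma aux_ge {c k u a : ℝ} (hc : 0 ≤ c) (hk : 0 < k) (hu : u ≤ 1) (hau : a ≤ u) :
    c / (c + k * (1 - a)) ≤ c / (c + k * (1 - u)) := by
  rcases hc.eq_or_lt with h | h
  · subst h; simp
  · have h1 : 0 < c + k * (1 - u) := by nlinarith
    apply div_le_div_of_nonneg_left hc h1
    nlinarith

lemma aux_eq {c k u a : ℝ} (hc : 0 < c) (hk : 0 < k) (hu : u ≤ 1) (ha : a ≤ 1) :
    c / (c + k * (1 - u)) = c / (c + k * (1 - a)) ↔ u = a := by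
  have h1 : 0 < c + k * (1 - u) := by nlinarith
  have h2 : 0 < c + k * (1 - a) := by nlinarith
  constructor
  · intro h
    rw [div_eq_div_iff h1.ne' h2.ne'] at h
    have h3 := mul_left_cancel₀ hc.ne' h
    have h4 : k * (u - a) = 0 := by linarith
    rcases mul_eq_zero.1 h4 with h | h <;> linarith
  · rintro rfl; rfl

lemma aux_sigma {v γ s g : ℝ} (hs : 0 ≤ s) (hg : 0 < g) (hs2 : s ^ 2 = 1 - v ^ 2)
    (hg2 : g ^ 2 = 1 - γ ^ 2) (h : v < -γ) : γ * s + v * g < 0 := by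
  have hid : (v + γ) * (s + g) = (γ * s + v * g) * (1 + v * γ + s * g) := by
    linear_combination (-γ * g) * hs2 - (v * s) * hg2
  have h1 : (v + γ) * (s + g) < 0 := by nlinarith
  have h2 : 0 < 1 + v * γ + s * g := by
    have : 0 ≤ s * g := by positivity
    nlinarith [sq_nonneg (v + γ), sq_nonneg (v - γ), sq_nonneg s, pow_pos hg 2]
  by_contra h3
  push Not at h3
  nlinarith [mul_nonneg h3 h2.le]

section
variable {E : Type*} [NormedAddCommGroup E] [InnerProductSpace ℝ E]

lemma aux_cs {v γ s g : ℝ} (hs : 0 ≤ s) (hs2 : s ^ 2 = 1 - v ^ 2)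
    (hg2 : g ^ 2 = 1 - γ ^ 2) {r x y : E} (hr : ‖r‖ = 1) (hx : ‖x‖ = 1) (hy : ‖y‖ = 1)
    (hv : ⟪r, x⟫ = v) : -s ≤ g * ⟪y, x⟫ - (γ * s + v * g) * ⟪r, y⟫ := by
  have hn : ‖g • x - (γ * s + v * g) • r‖ = s := by
    rw [← sq_eq_sq₀ (norm_nonneg _) hs, norm_sub_sq_real, norm_smul, norm_smul,
      real_inner_smul_left, real_inner_smul_right, real_inner_comm, hv, hr, hx, mul_one, mul_one,
      Real.norm_eq_abs, Real.norm_eq_abs, sq_abs, sq_abs]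
    linear_combination (1 - v ^ 2) * hg2 + (γ ^ 2 - 1) * hs2
  have h := neg_le_of_abs_le (abs_real_inner_le_norm y (g • x - (γ * s + v * g) • r))
  rw [hn, hy, inner_sub_right, real_inner_smul_right, real_inner_smul_right,
    real_inner_comm r y] at h
  linarith

lemma aux_lower {v γ s g : ℝ} (hs : 0 ≤ s) (hg : 0 < g) (hs2 : s ^ 2 = 1 - v ^ 2)
    (hg2 : g ^ 2 = 1 - γ ^ 2) (h : v < -γ) {r x y : E} (hr : ‖r‖ = 1) (hx : ‖x‖ = 1)
    (hy : ‖y‖ = 1) (hv : ⟪r, x⟫ = v) (ht : ⟪r, y⟫ ≤ γ) :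
    γ * v - s * g ≤ ⟪y, x⟫ ∧ (⟪y, x⟫ = γ * v - s * g → ⟪r, y⟫ = γ) := by
  have h1 := aux_cs hs hs2 hg2 hr hx hy hv
  have h2 := aux_sigma hs hg hs2 hg2 h
  set t := ⟪r, y⟫
  set u := ⟪y, x⟫
  set w := γ * s + v * g with hw
  have h3 : -s - w * (γ - t) ≤ g * u - w * γ := by linarith
  have h4 : g * (γ * v - s * g) = w * γ - s := by
    rw [hw]; linear_combination (-s) * hg2
  constructor
  · have : 0 ≤ (-w) * (γ - t) := mul_nonneg (by linarith) (by linarith)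
    have : g * (γ * v - s * g) ≤ g * u := by linarith
    exact le_of_mul_le_mul_left this hg
  · intro hu
    rw [hu, h4] at h3
    by_contra hne
    have : 0 < γ - t := sub_pos.2 (lt_of_le_of_ne ht hne)
    have : 0 < (-w) * (γ - t) := mul_pos (by linarith) this
    linarith

lemma aux_unit {a b : E} (ha : ‖a‖ = 1) (hb : ‖b‖ = 1) (h : ⟪a, b⟫ = 1) : a = b :=
  (inner_eq_one_iff_of_norm_eq_one ha hb).1 h

lemma aux_star {v γ s g : ℝ} (hs : 0 < s) (hs2 : s ^ 2 = 1 - v ^ 2)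
    (hg2 : g ^ 2 = 1 - γ ^ 2) {r x : E} (hr : ‖r‖ = 1) (hx : ‖x‖ = 1)
    (hv : ⟪r, x⟫ = v) (z : E)
    (hz : z = (γ * s + v * g) • (s⁻¹ • (r - v • x)) + (γ * v - s * g) • x) :
    ‖z‖ = 1 ∧ ⟪r, z⟫ = γ ∧ ⟪z, x⟫ = γ * v - s * g ∧
      ∀ y : E, ‖y‖ = 1 → ⟪r, y⟫ = γ → ⟪y, x⟫ = γ * v - s * g → y = z := by
  have hv' : ⟪x, r⟫ = v := by rw [real_inner_comm]; exact hv
  have hrr : ⟪r, r⟫ = 1 := by rw [real_inner_self_eq_norm_sq, hr]; norm_num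
  have hxx : ⟪x, x⟫ = 1 := by rw [real_inner_self_eq_norm_sq, hx]; norm_num
  have key : ∀ y : E, ⟪y, z⟫ =
      (γ * s + v * g) * (s⁻¹ * (⟪y, r⟫ - v * ⟪y, x⟫)) + (γ * v - s * g) * ⟪y, x⟫ := by
    intro y
    rw [hz]
    simp only [inner_add_right, inner_sub_right, real_inner_smul_right]
  have hsi : s⁻¹ * (1 - v ^ 2) = s := by rw [← hs2]; field_simp
  have h1 : ⟪r, z⟫ = γ := by
    rw [key, hrr, hv]
    linear_combination (γ * s + v * g) * hsi + γ * hs2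
  have h2 : ⟪z, x⟫ = γ * v - s * g := by
    rw [real_inner_comm, key, hxx, hv']; ring
  have h3 : ∀ y : E, ⟪r, y⟫ = γ → ⟪y, x⟫ = γ * v - s * g → ⟪y, z⟫ = 1 := by
    intro y hy1 hy2
    rw [key, hy2, real_inner_comm, hy1]
    have : s⁻¹ * (γ - v * (γ * v - s * g)) = γ * s + v * g := by
      have : s⁻¹ * s = 1 := inv_mul_cancel₀ hs.ne'
      linear_combination γ * hsi + v * g * this
    rw [this]
    linear_combination (γ ^ 2 + g ^ 2) * hs2 + hg2
  have hz1 : ‖z‖ = 1 := by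
    have := h3 z h1 h2
    rw [real_inner_self_eq_norm_sq] at this
    nlinarith [norm_nonneg z]
  exact ⟨hz1, h1, h2, fun y hy hy1 hy2 => aux_unit hy hz1 (h3 y hy1 hy2)⟩

lemma aux_proj {v s : ℝ} (hs : 0 ≤ s) (hs2 : s ^ 2 = 1 - v ^ 2) {r x : E} (hr : ‖r‖ = 1)
    (hx : ‖x‖ = 1) (hv : ⟪r, x⟫ = v) : ‖r - v • x‖ = s := by
  rw [← sq_eq_sq₀ (norm_nonneg _) hs, norm_sub_sq_real, norm_smul,
      real_inner_smul_right, hv, hr, hx, mul_one, Real.norm_eq_abs, sq_abs]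
  linear_combination -hs2

end

lemma aux_exists {n : ℕ} (hn : 1 ≤ n) {γ g : ℝ} (hg2 : g ^ 2 = 1 - γ ^ 2)
    (r : EuclideanSpace ℝ (Fin (n + 1))) (hr : ‖r‖ = 1) :
    ∃ y : EuclideanSpace ℝ (Fin (n + 1)), ‖y‖ = 1 ∧ ⟪r, y⟫ = γ := by
  have hrr : ⟪r, r⟫ = 1 := by rw [real_inner_self_eq_norm_sq, hr]; norm_num
  obtain ⟨e, he, hre⟩ : ∃ e : EuclideanSpace ℝ (Fin (n + 1)), ‖e‖ = 1 ∧ ⟪r, e⟫ = 0 := by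
    have hne : (Submodule.span ℝ {r})ᗮ ≠ ⊥ := by
      intro h
      rw [Submodule.orthogonal_eq_bot_iff] at h
      have h1 := finrank_span_le_card (R := ℝ) ({r} : Set (EuclideanSpace ℝ (Fin (n + 1))))
      rw [h, finrank_top, finrank_euclideanSpace] at h1
      simp at h1
      omega
    obtain ⟨w, hw, hw0⟩ := Submodule.exists_mem_ne_zero_of_ne_bot hne
    rw [Submodule.mem_orthogonal_singleton_iff_inner_right] at hw
    refine ⟨‖w‖⁻¹ • w, ?_, ?_⟩
    · rw [norm_smul, norm_inv, norm_norm, inv_mul_cancel₀ (norm_ne_zero_iff.2 hw0)]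
    · rw [real_inner_smul_right, hw, mul_zero]
  refine ⟨γ • r + g • e, ?_, ?_⟩
  · rw [← sq_eq_sq₀ (norm_nonneg _) zero_le_one, norm_add_sq_real, norm_smul, norm_smul,
      real_inner_smul_left, real_inner_smul_right, hre, hr, he, mul_one, mul_one,
      Real.norm_eq_abs, Real.norm_eq_abs, sq_abs, sq_abs]
    linear_combination hg2
  · rw [inner_add_right, real_inner_smul_right, real_inner_smul_right, hrr, hre]; ring

theorem stmt7 (n : ℕ) (hn : 1 ≤ n) (k : ℝ) (hk : 0 < k) (γ : ℝ) (hγ : -1 < γ ∧ γ < 1)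
    (r : EuclideanSpace ℝ (Fin (n + 1))) (hr : ‖r‖ = 1)
    (Y : Set (EuclideanSpace ℝ (Fin (n + 1))))
    (hY : Y = {y : EuclideanSpace ℝ (Fin (n + 1)) | ‖y‖ = 1 ∧ ⟪r, y⟫ ≤ γ})
    (α σ : ℝ → ℝ)
    (hα : ∀ w : ℝ, α w = γ * w - Real.sqrt ((1 - w ^ 2) * (1 - γ ^ 2)))
    (hσ : ∀ w : ℝ, σ w = γ * Real.sqrt (1 - w ^ 2) + w * Real.sqrt (1 - γ ^ 2))
    (x : EuclideanSpace ℝ (Fin (n + 1))) (hx : ‖x‖ = 1) :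
    -- the value of the minimum
    (-γ ≤ ⟪r, x⟫ →
      IsLeast {v : ℝ | ∃ y ∈ Y, v = synV k r x y}
        ((1 - ⟪r, x⟫) / (1 - ⟪r, x⟫ + 2 * k))) ∧
    (⟪r, x⟫ < -γ →
      IsLeast {v : ℝ | ∃ y ∈ Y, v = synV k r x y}
        ((1 - ⟪r, x⟫) / (1 - ⟪r, x⟫ + k * (1 - α ⟪r, x⟫)))) ∧
    -- the set of minimizers, in the four cases
    (x = r →
      {y ∈ Y | synV k r x y = (1 - ⟪r, x⟫) / (1 - ⟪r, x⟫ + 2 * k)} = Y) ∧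
    (-γ ≤ ⟪r, x⟫ → x ≠ r →
      {y ∈ Y | synV k r x y = (1 - ⟪r, x⟫) / (1 - ⟪r, x⟫ + 2 * k)} = {-x}) ∧
    (-1 < ⟪r, x⟫ → ⟪r, x⟫ < -γ →
      {y ∈ Y | synV k r x y =
          (1 - ⟪r, x⟫) / (1 - ⟪r, x⟫ + k * (1 - α ⟪r, x⟫))} =
        {σ ⟪r, x⟫ • (‖tangProj x r‖⁻¹ • tangProj x r) + α ⟪r, x⟫ • x}) ∧
    (⟪r, x⟫ = -1 →
      {y ∈ Y | synV k r x y =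
          (1 - ⟪r, x⟫) / (1 - ⟪r, x⟫ + k * (1 - α ⟪r, x⟫))} =
        {y : EuclideanSpace ℝ (Fin (n + 1)) | ‖y‖ = 1 ∧ ⟪r, y⟫ = γ}) := by
  obtain ⟨hγ1, hγ2⟩ := hγ
  subst hY
  have hVd : ∀ y, synV k r x y = (1 - ⟪r, x⟫) / ((1 - ⟪r, x⟫) + k * (1 - ⟪y, x⟫)) :=
    fun y => rfl
  have hab : ∀ a b : EuclideanSpace ℝ (Fin (n + 1)), ‖a‖ = 1 → ‖b‖ = 1 →
      -1 ≤ ⟪a, b⟫ ∧ ⟪a, b⟫ ≤ 1 := by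
    intro a b ha hb
    have := abs_le.1 (abs_real_inner_le_norm a b)
    rwa [ha, hb, mul_one] at this
  have hxx : ⟪x, x⟫ = 1 := by rw [real_inner_self_eq_norm_sq, hx]; norm_num
  have htp : tangProj x r = r - ⟪r, x⟫ • x := by
    rw [tangProj, real_inner_comm]
  have h2k : 2 * k = k * (1 - (-1)) := by ring
  rw [htp, h2k]
  obtain ⟨hv1, hv2⟩ := hab r x hr hx
  obtain ⟨v, hv⟩ : ∃ v, ⟪r, x⟫ = v := ⟨_, rfl⟩
  rw [hv] at hv1 hv2 ⊢
  simp only [hVd, hv]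
  obtain ⟨s, hsd⟩ : ∃ s, s = Real.sqrt (1 - v ^ 2) := ⟨_, rfl⟩
  obtain ⟨g, hgd⟩ : ∃ g, g = Real.sqrt (1 - γ ^ 2) := ⟨_, rfl⟩
  have hs : 0 ≤ s := hsd ▸ Real.sqrt_nonneg _
  have hs2 : s ^ 2 = 1 - v ^ 2 := by rw [hsd]; exact Real.sq_sqrt (by nlinarith)
  have hg : 0 < g := by rw [hgd]; exact Real.sqrt_pos.2 (by nlinarith)
  have hg2 : g ^ 2 = 1 - γ ^ 2 := by rw [hgd]; exact Real.sq_sqrt (by nlinarith)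
  have hαv : α v = γ * v - s * g := by
    rw [hα, Real.sqrt_mul (by nlinarith), hsd, hgd]
  have hσv : σ v = γ * s + v * g := by rw [hσ, hsd, hgd]
  rw [aux_proj hs hs2 hr hx hv, hαv, hσv]
  have hneg : ⟪-x, x⟫ = -1 := by rw [inner_neg_left, hxx]
  have hα1 : γ * v - s * g ≤ 1 := by
    have : 0 ≤ s * g := by positivity
    nlinarith
  -- minimizers when `v = -1`
  have hopp : v = -1 → ∀ y : EuclideanSpace ℝ (Fin (n + 1)), ⟪y, x⟫ = -⟪r, y⟫ := by
    intro h y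
    have : x = -r := by
      apply aux_unit hx (by rw [norm_neg, hr])
      rw [inner_neg_right, real_inner_comm, hv, h]; ring
    rw [this, inner_neg_right, real_inner_comm]
  have hs0 : v = -1 → s = 0 := by
    intro h
    have : s ^ 2 = 0 := by rw [hs2, h]; norm_num
    exact pow_eq_zero_iff (two_ne_zero) |>.1 this
  have hspos : -1 < v → v < -γ → 0 < s := by
    intro h h'
    rw [hsd]; exact Real.sqrt_pos.2 (by nlinarith)
  refine ⟨?_, ?_, ?_, ?_, ?_, ?_⟩
  · intro h
    constructor
    · refine ⟨-x, ⟨by rw [norm_neg, hx], ?_⟩, ?_⟩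
      · rw [inner_neg_right, hv]; linarith
      · rw [hneg]
    · rintro _ ⟨y, ⟨hy, -⟩, rfl⟩
      exact aux_ge (by linarith) hk (hab y x hy hx).2 (hab y x hy hx).1
  · intro h
    constructor
    · rcases hv1.eq_or_lt with h1 | h1
      · obtain ⟨y, hy, hyr⟩ := aux_exists hn hg2 r hr
        refine ⟨y, ⟨hy, hyr.le⟩, ?_⟩
        rw [hopp h1.symm, hyr, hs0 h1.symm, ← h1]; ring_nf
      · obtain ⟨a, b, c, -⟩ := aux_star (hspos h1 h) hs2 hg2 hr hx hv _ rfl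
        exact ⟨_, ⟨a, b.le⟩, by rw [c]⟩
    · rintro _ ⟨y, ⟨hy, hyr⟩, rfl⟩
      exact aux_ge (by linarith) hk (hab y x hy hx).2
        (aux_lower hs hg hs2 hg2 h hr hx hy hv hyr).1
  · intro h
    have : v = 1 := by rw [← hv, ← h, hxx]
    ext y
    simp [this]
  · intro h hne
    have hlt : v < 1 := by
      refine lt_of_le_of_ne hv2 fun h1 => hne ?_
      exact (aux_unit hr hx (hv.trans h1)).symm
    ext y
    constructor
    · rintro ⟨⟨hy, hyr⟩, he⟩
      rw [aux_eq (by linarith) hk (hab y x hy hx).2 (by norm_num)] at he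
      apply aux_unit hy (by rw [norm_neg, hx])
      rw [inner_neg_right, he]; ring
    · intro hy
      obtain rfl : y = -x := hy
      refine ⟨⟨by rw [norm_neg, hx], ?_⟩, ?_⟩
      · rw [inner_neg_right, hv]; linarith
      · rw [hneg]
  · intro h1 h
    obtain ⟨a, b, c, d⟩ := aux_star (hspos h1 h) hs2 hg2 hr hx hv _ rfl
    ext y
    constructor
    · rintro ⟨⟨hy, hyr⟩, he⟩
      rw [aux_eq (by linarith) hk (hab y x hy hx).2 hα1] at he
      exact d y hy ((aux_lower hs hg hs2 hg2 h hr hx hy hv hyr).2 he) he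
    · intro hy
      rw [Set.mem_singleton_iff] at hy
      rw [← hy] at a b c
      exact ⟨⟨a, b.le⟩, by rw [c]⟩
  · intro h1
    have hα' : γ * v - s * g = -γ := by rw [hs0 h1, h1]; ring
    rw [hα'] at hα1 ⊢
    ext y
    constructor
    · rintro ⟨⟨hy, hyr⟩, he⟩
      rw [aux_eq (by linarith) hk (hab y x hy hx).2 hα1, hopp h1] at he
      exact ⟨hy, by linarith⟩
    · rintro ⟨hy, hyr⟩
      exact ⟨⟨hy, hyr.le⟩, by rw [hopp h1, hyr]⟩
end

section
/- Define ψ(x) := 1 − m_V(x) for x ∈ Sⁿ, where m_V(x) := min_{y ∈ Y} V(x,y). Then ψ(x) > 0 for all x ∈ Sⁿ, and the minimum of ψ over Sⁿ, which coincides with the minimum of ψ over Y, equals (1 + γ)/(2/k + 1 + γ). -/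
open scoped RealInnerProductSpace

/-- `m_V(x) = min_{y ∈ Y} V(x,y)`, where `Y = {y ∈ Sⁿ : ⟪r,y⟫ ≤ γ}`. -/
noncomputable def minVy {n : ℕ} (k γ : ℝ) (r x : EuclideanSpace ℝ (Fin (n + 1))) : ℝ :=
  sInf {v : ℝ | ∃ y : EuclideanSpace ℝ (Fin (n + 1)),
    ‖y‖ = 1 ∧ ⟪r, y⟫ ≤ γ ∧ v = synV k r x y}

/-- `ψ(x) = 1 - m_V(x)`. -/
noncomputable def stickygap {n : ℕ} (k γ : ℝ) (r x : EuclideanSpace ℝ (Fin (n + 1))) : ℝ :=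
  1 - minVy k γ r x

theorem exists_orth {n : ℕ} (hn : 1 ≤ n) (r : EuclideanSpace ℝ (Fin (n + 1))) :
    ∃ e : EuclideanSpace ℝ (Fin (n + 1)), ‖e‖ = 1 ∧ ⟪r, e⟫ = 0 := by
  have h1 := Submodule.finrank_add_finrank_orthogonal (ℝ ∙ r)
  have h2 : Module.finrank ℝ (ℝ ∙ r) ≤ 1 := by
    simpa using finrank_span_le_card (R := ℝ) ({r} : Set (EuclideanSpace ℝ (Fin (n + 1))))
  rw [finrank_euclideanSpace_fin] at h1
  have h3 : 0 < Module.finrank ℝ (ℝ ∙ r)ᗮ := by omega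
  have := Module.finrank_pos_iff.1 h3
  obtain ⟨⟨v, hv⟩, hv0⟩ := exists_ne (0 : (ℝ ∙ r)ᗮ)
  have hv1 : v ≠ 0 := fun h => hv0 (by simpa using h)
  refine ⟨‖v‖⁻¹ • v, norm_smul_inv_norm (𝕜 := ℝ) hv1, ?_⟩
  rw [real_inner_smul_right, Submodule.mem_orthogonal_singleton_iff_inner_right.1 hv, mul_zero]

theorem inner_bd {n : ℕ} {x y : EuclideanSpace ℝ (Fin (n + 1))} (hx : ‖x‖ = 1) (hy : ‖y‖ = 1) :
    -1 ≤ ⟪x, y⟫ ∧ ⟪x, y⟫ ≤ 1 := by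
  have := abs_real_inner_le_norm x y
  rw [hx, hy, mul_one] at this
  exact abs_le.1 this

theorem exists_y {n : ℕ} (hn : 1 ≤ n) (γ : ℝ) (hγ : -1 < γ ∧ γ < 1)
    (r x : EuclideanSpace ℝ (Fin (n + 1))) (hr : ‖r‖ = 1) :
    ∃ y : EuclideanSpace ℝ (Fin (n + 1)), ‖y‖ = 1 ∧ ⟪r, y⟫ = γ ∧ ⟪y, x⟫ ≤ γ * ⟪r, x⟫ := by
  obtain ⟨e, he, hre, hex⟩ : ∃ e : EuclideanSpace ℝ (Fin (n + 1)), ‖e‖ = 1 ∧ ⟪r, e⟫ = 0 ∧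
      ⟪e, x⟫ ≤ 0 := by
    obtain ⟨e, he, hre⟩ := exists_orth hn r
    rcases le_total ⟪e, x⟫ 0 with h | h
    · exact ⟨e, he, hre, h⟩
    · exact ⟨-e, by simpa using he, by simpa using hre, by simpa using h⟩
  have hs := Real.sq_sqrt (show 0 ≤ 1 - γ ^ 2 by nlinarith [hγ.1, hγ.2])
  refine ⟨γ • r + √(1 - γ ^ 2) • e, ?_, ?_, ?_⟩
  · rw [← sq_eq_sq₀ (norm_nonneg _) zero_le_one, norm_add_sq_real, norm_smul, norm_smul, hr, he,
      real_inner_smul_left, real_inner_smul_right, hre]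
    simp only [mul_one, mul_zero, Real.norm_eq_abs, sq_abs]
    linarith
  · rw [inner_add_right, real_inner_smul_right, real_inner_smul_right, hre,
      real_inner_self_eq_norm_sq, hr]
    ring
  · rw [inner_add_left, real_inner_smul_left, real_inner_smul_left]
    nlinarith [Real.sqrt_nonneg (1 - γ ^ 2)]

theorem gap_ge {n : ℕ} (hn : 1 ≤ n) (k : ℝ) (hk : 0 < k) (γ : ℝ) (hγ : -1 < γ ∧ γ < 1)
    (r x : EuclideanSpace ℝ (Fin (n + 1))) (hr : ‖r‖ = 1) (hx : ‖x‖ = 1) :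
    minVy k γ r x ≤ 2 / (2 + k * (1 + γ)) := by
  obtain ⟨y, hy, hry, hyx⟩ := exists_y hn γ hγ r x hr
  have hb : BddBelow {v : ℝ | ∃ y : EuclideanSpace ℝ (Fin (n + 1)),
      ‖y‖ = 1 ∧ ⟪r, y⟫ ≤ γ ∧ v = synV k r x y} := by
    refine ⟨0, ?_⟩
    rintro v ⟨z, hz, -, rfl⟩
    have h1 := (inner_bd hr hx).2
    have h2 := (inner_bd hz hx).2
    have h3 := mul_nonneg hk.le (sub_nonneg.2 h2)
    exact div_nonneg (by linarith) (by linarith)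
  refine (csInf_le hb ⟨y, hy, hry.le, rfl⟩).trans ?_
  obtain ⟨h1, h2⟩ := inner_bd hr hx
  unfold synV
  generalize ⟪r, x⟫ = u at *
  generalize ⟪y, x⟫ = w at *
  obtain ⟨g1, g2⟩ := hγ
  have hw : 0 < 1 - w := by
    have : γ * u < 1 := by
      rcases le_total 0 u with h | h <;> nlinarith
    linarith
  have h3 := mul_pos hk hw
  have h4 : 0 < k * (1 + γ) := mul_pos hk (by linarith)
  rw [div_le_div_iff₀ (by linarith) (by linarith)]
  have h5 : (1 - u) * (1 + γ) ≤ 2 * (1 - w) := by nlinarith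
  nlinarith [mul_le_mul_of_nonneg_left h5 hk.le]

theorem gap_le {n : ℕ} (hn : 1 ≤ n) (k : ℝ) (hk : 0 < k) (γ : ℝ) (hγ : -1 < γ ∧ γ < 1)
    (r : EuclideanSpace ℝ (Fin (n + 1))) (hr : ‖r‖ = 1) :
    2 / (2 + k * (1 + γ)) ≤ minVy k γ r (-r) := by
  obtain ⟨y, hy, hry, -⟩ := exists_y hn γ hγ r r hr
  refine le_csInf ⟨_, y, hy, hry.le, rfl⟩ ?_
  rintro v ⟨z, hz, hrz, rfl⟩
  have h1 := (inner_bd hr hz).1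
  unfold synV
  rw [inner_neg_right, inner_neg_right, real_inner_self_eq_norm_sq, hr, real_inner_comm]
  have h3 := mul_nonneg hk.le (show 0 ≤ 1 + ⟪r, z⟫ by linarith)
  have h4 := mul_le_mul_of_nonneg_left hrz hk.le
  rw [div_le_div_iff₀ (by nlinarith) (by nlinarith)]
  nlinarith

theorem stmt8 (n : ℕ) (hn : 1 ≤ n) (k : ℝ) (hk : 0 < k) (γ : ℝ) (hγ : -1 < γ ∧ γ < 1)
    (r : EuclideanSpace ℝ (Fin (n + 1))) (hr : ‖r‖ = 1) :
    (∀ x : EuclideanSpace ℝ (Fin (n + 1)), ‖x‖ = 1 → 0 < stickygap k γ r x) ∧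
    IsLeast {v : ℝ | ∃ x : EuclideanSpace ℝ (Fin (n + 1)), ‖x‖ = 1 ∧ v = stickygap k γ r x}
      ((1 + γ) / (2 / k + 1 + γ)) ∧
    IsLeast {v : ℝ | ∃ x : EuclideanSpace ℝ (Fin (n + 1)),
        ‖x‖ = 1 ∧ ⟪r, x⟫ ≤ γ ∧ v = stickygap k γ r x}
      ((1 + γ) / (2 / k + 1 + γ)) := by
  have hv : (1 + γ) / (2 / k + 1 + γ) = 1 - 2 / (2 + k * (1 + γ)) := by
    have h4 : 0 < k * (1 + γ) := mul_pos hk (by linarith [hγ.1])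
    have h5 : 0 < 2 / k := by positivity
    have h6 : 2 / k + 1 + γ ≠ 0 := by linarith [hγ.1]
    have h7 : 2 + k * (1 + γ) ≠ 0 := by linarith
    have h8 : 2 / k + 1 + γ = (2 + k * (1 + γ)) / k := by field_simp; ring
    rw [h8, div_div_eq_mul_div, eq_sub_iff_add_eq, ← add_div, div_eq_one_iff_eq h7]
    ring
  have hpos : 0 < (1 + γ) / (2 / k + 1 + γ) := by
    have h5 : 0 < 2 / k := by positivity
    exact div_pos (by linarith [hγ.1]) (by linarith [hγ.1])
  have hge : ∀ x : EuclideanSpace ℝ (Fin (n + 1)), ‖x‖ = 1 →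
      (1 + γ) / (2 / k + 1 + γ) ≤ stickygap k γ r x := by
    intro x hx
    rw [hv]
    have := gap_ge hn k hk γ hγ r x hr hx
    unfold stickygap
    linarith
  have hr' : ‖-r‖ = 1 := by rwa [norm_neg]
  have heq : (1 + γ) / (2 / k + 1 + γ) = stickygap k γ r (-r) := by
    refine le_antisymm (hge _ hr') ?_
    rw [hv]
    have := gap_le hn k hk γ hγ r hr
    unfold stickygap
    linarith
  refine ⟨fun x hx => hpos.trans_le (hge x hx), ⟨⟨-r, hr', heq⟩, ?_⟩,
    ⟨⟨-r, hr', ?_, heq⟩, ?_⟩⟩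
  · rintro v ⟨x, hx, rfl⟩
    exact hge x hx
  · rw [inner_neg_right, real_inner_self_eq_norm_sq, hr]
    linarith [hγ.1]
  · rintro v ⟨x, hx, -, rfl⟩
    exact hge x hx
end

section
/- For every x ∈ Sⁿ and every y ∈ Y: 0 < 1 + k − √(1 + 2kγ + k²) ≤ 1 − rᵀx + k(1 − yᵀx) ≤ 1 + k + √(1 + 2kγ + k²). -/
open scoped RealInnerProductSpace

theorem stmt10 (n : ℕ) (hn : 1 ≤ n) (k : ℝ) (hk : 0 < k) (γ : ℝ) (hγ : -1 < γ ∧ γ < 1)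
    (r : EuclideanSpace ℝ (Fin (n + 1))) (hr : ‖r‖ = 1)
    (x y : EuclideanSpace ℝ (Fin (n + 1))) (hx : ‖x‖ = 1)
    (hy : ‖y‖ = 1) (hyY : ⟪r, y⟫ ≤ γ) :
    0 < 1 + k - Real.sqrt (1 + 2 * k * γ + k ^ 2) ∧
    1 + k - Real.sqrt (1 + 2 * k * γ + k ^ 2) ≤ 1 - ⟪r, x⟫ + k * (1 - ⟪y, x⟫) ∧
    1 - ⟪r, x⟫ + k * (1 - ⟪y, x⟫) ≤ 1 + k + Real.sqrt (1 + 2 * k * γ + k ^ 2) := by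
  have h1 : Real.sqrt (1 + 2 * k * γ + k ^ 2) < 1 + k := by
    rw [Real.sqrt_lt' (by linarith)]
    nlinarith [mul_lt_mul_of_pos_left hγ.2 hk]
  have h2 : ‖r + k • y‖ ≤ Real.sqrt (1 + 2 * k * γ + k ^ 2) := by
    apply Real.le_sqrt_of_sq_le
    rw [norm_add_sq_real, norm_smul, inner_smul_right, hr, hy, mul_one, Real.norm_eq_abs, sq_abs]
    nlinarith [mul_le_mul_of_nonneg_left hyY hk.le]
  have h3 := abs_real_inner_le_norm (r + k • y) x
  rw [hx, mul_one, inner_add_left, real_inner_smul_left] at h3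
  obtain ⟨h4, h5⟩ := abs_le.mp (h3.trans h2)
  refine ⟨by linarith, by linarith, by linarith⟩
end

section
/- For every x ∈ Sⁿ and every y ∈ Y: ‖x − r‖² / (2(1 + k + √(1 + 2kγ + k²))) ≤ V(x,y) ≤ ‖x − r‖² / (2(1 + k − √(1 + 2kγ + k²))). -/
open scoped RealInnerProductSpace

theorem stmt11 (n : ℕ) (hn : 1 ≤ n) (k : ℝ) (hk : 0 < k) (γ : ℝ) (hγ : -1 < γ ∧ γ < 1)
    (r : EuclideanSpace ℝ (Fin (n + 1))) (hr : ‖r‖ = 1)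
    (x y : EuclideanSpace ℝ (Fin (n + 1))) (hx : ‖x‖ = 1)
    (hy : ‖y‖ = 1) (hyY : ⟪r, y⟫ ≤ γ) :
    ‖x - r‖ ^ 2 / (2 * (1 + k + Real.sqrt (1 + 2 * k * γ + k ^ 2))) ≤ synV k r x y ∧
    synV k r x y ≤ ‖x - r‖ ^ 2 / (2 * (1 + k - Real.sqrt (1 + 2 * k * γ + k ^ 2))) := by
  have hN : ‖r + k • y‖ ^ 2 = 1 + 2 * k * ⟪r, y⟫ + k ^ 2 := by
    rw [norm_add_sq_real, norm_smul, inner_smul_right, hr, hy, Real.norm_eq_abs, mul_one, sq_abs]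
    ring
  have hs : ‖r + k • y‖ ≤ Real.sqrt (1 + 2 * k * γ + k ^ 2) := by
    apply Real.le_sqrt_of_sq_le
    rw [hN]
    nlinarith
  have hs1 : Real.sqrt (1 + 2 * k * γ + k ^ 2) < 1 + k := by
    rw [Real.sqrt_lt' (by linarith)]
    nlinarith [hγ.2]
  have hs0 := Real.sqrt_nonneg (1 + 2 * k * γ + k ^ 2)
  have hc := abs_real_inner_le_norm (r + k • y) x
  rw [hx, mul_one, inner_add_left, real_inner_smul_left] at hc
  have hc' := abs_le.1 (hc.trans hs)
  have hxr : ‖x - r‖ ^ 2 = 2 * (1 - ⟪r, x⟫) := by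
    rw [norm_sub_sq_real, hx, hr, real_inner_comm]
    ring
  have h0 : 0 ≤ 1 - ⟪r, x⟫ := by
    have := sq_nonneg ‖x - r‖
    linarith
  unfold synV
  rw [hxr, mul_div_mul_left _ _ (two_ne_zero), mul_div_mul_left _ _ (two_ne_zero)]
  constructor
  · apply div_le_div_of_nonneg_left h0 <;> linarith [hc'.1, hc'.2]
  · apply div_le_div_of_nonneg_left h0 <;> linarith [hc'.1, hc'.2]
end

section
/- Let c ∈ [0,1). For every x ∈ Sⁿ and y ∈ Y with V(x,y) ≤ c, one has ‖Π(x)∇V^y(x)‖² ≥ (2k(1 − c)(1 − γ) / (1 + k + √(1 + 2kγ + k²))²) · V(x,y). -/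
open scoped RealInnerProductSpace

theorem stmt12 (n : ℕ) (hn : 1 ≤ n) (k : ℝ) (hk : 0 < k) (γ : ℝ) (hγ : -1 < γ ∧ γ < 1)
    (r : EuclideanSpace ℝ (Fin (n + 1))) (hr : ‖r‖ = 1)
    (c : ℝ) (hc : 0 ≤ c ∧ c < 1)
    (x y : EuclideanSpace ℝ (Fin (n + 1))) (hx : ‖x‖ = 1)
    (hy : ‖y‖ = 1) (hyY : ⟪r, y⟫ ≤ γ)
    (hVc : synV k r x y ≤ c) :
    (2 * k * (1 - c) * (1 - γ) / (1 + k + Real.sqrt (1 + 2 * k * γ + k ^ 2)) ^ 2) *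
        synV k r x y ≤
      ‖tangProj x (gradVy k r y x)‖ ^ 2 := by
  have hxx : ⟪x, x⟫ = 1 := by rw [real_inner_self_eq_norm_sq, hx]; norm_num
  have hrr : ⟪r, r⟫ = 1 := by rw [real_inner_self_eq_norm_sq, hr]; norm_num
  have hyy : ⟪y, y⟫ = 1 := by rw [real_inner_self_eq_norm_sq, hy]; norm_num
  have ha : 0 ≤ 1 - ⟪r, x⟫ := by
    have := real_inner_le_norm r x
    rw [hr, hx] at this; linarith
  have hb : 0 ≤ 1 - ⟪y, x⟫ := by
    have := real_inner_le_norm y x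
    rw [hy, hx] at this; linarith
  have hD : 0 < (1 - ⟪r, x⟫) + k * (1 - ⟪y, x⟫) := by
    have hkb := mul_nonneg hk.le hb
    rcases (add_nonneg ha hkb).lt_or_eq with h | h
    · exact h
    · exfalso
      have h1 : ⟪r, x⟫ = 1 := by linarith
      have h2 : k * (1 - ⟪y, x⟫) = 0 := by linarith
      have h3 : ⟪y, x⟫ = 1 := by
        rcases mul_eq_zero.1 h2 with h | h <;> linarith
      have e1 : r = x := (inner_eq_one_iff_of_norm_eq_one hr hx).1 h1
      have e2 : y = x := (inner_eq_one_iff_of_norm_eq_one hy hx).1 h3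
      rw [e1, e2, hxx] at hyY
      linarith [hγ.2]
  have hgrad : gradVy k r y x = (k / ((1 - ⟪r, x⟫) + k * (1 - ⟪y, x⟫)) ^ 2) •
      ((1 - ⟪r, x⟫) • y - (1 - ⟪y, x⟫) • r) := by
    unfold gradVy
    apply HasGradientAt.gradient
    rw [hasGradientAt_iff_hasFDerivAt]
    have hda : HasFDerivAt (fun z => 1 - ⟪r, z⟫) (-(innerSL ℝ r)) x :=
      ((innerSL ℝ r).hasFDerivAt (x := x)).const_sub 1
    have hdb : HasFDerivAt (fun z => 1 - ⟪y, z⟫) (-(innerSL ℝ y)) x :=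
      ((innerSL ℝ y).hasFDerivAt (x := x)).const_sub 1
    have hdd := hda.fun_add (hdb.const_mul k)
    have hdi := (hasDerivAt_inv hD.ne').comp_hasFDerivAt x hdd
    have key := hda.mul hdi
    have hfun : (fun z => (1 - ⟪r, z⟫) / ((1 - ⟪r, z⟫) + k * (1 - ⟪y, z⟫))) =
        (fun z => 1 - ⟪r, z⟫) * ((fun t : ℝ => t⁻¹) ∘
          (fun z => (1 - ⟪r, z⟫) + k * (1 - ⟪y, z⟫))) := by
      funext z
      simp [div_eq_mul_inv]
    rw [hfun]
    refine HasFDerivAt.congr_fderiv key ?_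
    ext v
    simp [inner_sub_left, inner_smul_left]
    field_simp
    ring
  have hnorm : ‖tangProj x (gradVy k r y x)‖ ^ 2 =
      (k / ((1 - ⟪r, x⟫) + k * (1 - ⟪y, x⟫)) ^ 2) ^ 2 *
      (2 * (1 - ⟪r, x⟫) * (1 - ⟪y, x⟫) * (1 - ⟪r, y⟫)) := by
    rw [hgrad, ← real_inner_self_eq_norm_sq]
    unfold tangProj
    generalize k / ((1 - ⟪r, x⟫) + k * (1 - ⟪y, x⟫)) ^ 2 = t
    simp only [inner_sub_left, inner_sub_right, inner_smul_left, inner_smul_right, hxx, hrr, hyy,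
      real_inner_comm r x, real_inner_comm y x, real_inner_comm r y, RCLike.conj_to_real]
    simp only [real_inner_comm]
    ring
  have hDM : (1 - ⟪r, x⟫) + k * (1 - ⟪y, x⟫) ≤ 1 + k + Real.sqrt (1 + 2 * k * γ + k ^ 2) := by
    have h1 : ‖r + k • y‖ ≤ Real.sqrt (1 + 2 * k * γ + k ^ 2) := by
      apply Real.le_sqrt_of_sq_le
      rw [← real_inner_self_eq_norm_sq]
      simp only [inner_add_left, inner_add_right, inner_smul_left, inner_smul_right, hrr, hyy,
        real_inner_comm r y, RCLike.conj_to_real]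
      have := mul_le_mul_of_nonneg_left hyY hk.le
      nlinarith
    have h2 := abs_real_inner_le_norm (r + k • y) x
    rw [hx, inner_add_left, inner_smul_left, RCLike.conj_to_real] at h2
    have h3 := neg_abs_le (⟪r, x⟫ + k * ⟪y, x⟫)
    linarith
  rw [hnorm]
  unfold synV at *
  generalize 1 - ⟪r, x⟫ = a at *
  generalize 1 - ⟪y, x⟫ = b at *
  generalize 1 + k + Real.sqrt (1 + 2 * k * γ + k ^ 2) = M at *
  have hV : 0 ≤ a / (a + k * b) := by positivity
  have hV1 : 1 - c ≤ k * b / (a + k * b) := by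
    have : k * b / (a + k * b) = 1 - a / (a + k * b) := by field_simp; ring
    linarith
  have e : (k / (a + k * b) ^ 2) ^ 2 * (2 * a * b * (1 - ⟪r, y⟫)) =
      (2 * k * (k * b / (a + k * b)) * (1 - ⟪r, y⟫) / (a + k * b) ^ 2) * (a / (a + k * b)) := by
    field_simp
  rw [e]
  have h1 : 0 ≤ 1 - γ := by linarith [hγ.2]
  have h2 : 0 ≤ 1 - ⟪r, y⟫ := by linarith
  have h3 : 0 ≤ 1 - c := by linarith [hc.2]
  gcongr
end

section
/- Let A := [[0₃, I₃],[0₃, 0₃]] ∈ ℝ^{6×6} and B := [0₃; I₃] ∈ ℝ^{6×3}. For each b > 0, ℓ_P > 0, ℓ_H > 0, each symmetric positive definite R̂ ∈ ℝ^{3×3}, and each symmetric positive definite H ∈ ℝ^{6×6}, there exist K ∈ ℝ^{3×6} and symmetric positive definite matrices Q̂, P ∈ ℝ^{6×6} such that: (i) (A + BK)ᵀP + P(A + BK) ≼ −Q̂ − KᵀR̂K; (ii) (1/ℓ_P)P ≼ (1/ℓ_H)H (equivalently Ω_H(ℓ_H) ⊆ Ω_P(ℓ_P)); and (iii) (1/b²)KᵀK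 ≼ (1/ℓ_P)P (equivalently Ω_P(ℓ_P) ⊆ Ω_{KᵀK}(b²)). -/
open Matrix

/-- The double-integrator state matrix `A = [[0, I],[0, 0]] ∈ ℝ^{6×6}`. -/
def matA : Matrix (Fin 6) (Fin 6) ℝ :=
  Matrix.of fun i j => if (j : ℕ) = (i : ℕ) + 3 then 1 else 0

/-- The double-integrator input matrix `B = [0; I] ∈ ℝ^{6×3}`. -/
def matB : Matrix (Fin 6) (Fin 3) ℝ :=
  Matrix.of fun i j => if (i : ℕ) = (j : ℕ) + 3 then 1 else 0

lemma aux_lower_s15 {n : ℕ} (H : Matrix (Fin n) (Fin n) ℝ) (hH : H.PosDef) :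
    ∃ h : ℝ, 0 < h ∧ ∀ x : Fin n → ℝ, h * (x ⬝ᵥ x) ≤ x ⬝ᵥ (H *ᵥ x) := by
  have hc : Continuous fun x : Fin n → ℝ => x ⬝ᵥ (H *ᵥ x) := by
    unfold Matrix.mulVec dotProduct; fun_prop
  have hd : Continuous fun x : Fin n → ℝ => x ⬝ᵥ x := by
    unfold dotProduct; fun_prop
  let S : Set (Fin n → ℝ) := {x | x ⬝ᵥ x = 1}
  have hS : IsCompact S := by
    apply Metric.isCompact_of_isClosed_isBounded
    · exact isClosed_eq hd continuous_const
    · apply (Metric.isBounded_closedBall (x := (0 : Fin n → ℝ)) (r := 1)).subset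
      intro x hx
      rw [mem_closedBall_zero_iff, pi_norm_le_iff_of_nonneg zero_le_one]
      intro i
      have h1 : x i * x i ≤ x ⬝ᵥ x :=
        Finset.single_le_sum (f := fun i => x i * x i) (fun i _ => mul_self_nonneg _)
          (Finset.mem_univ i)
      have h2 : x ⬝ᵥ x = 1 := hx
      rw [Real.norm_eq_abs, abs_le]
      constructor <;> nlinarith
  have key : ∃ h : ℝ, 0 < h ∧ ∀ x ∈ S, h ≤ x ⬝ᵥ (H *ᵥ x) := by
    rcases S.eq_empty_or_nonempty with he | hne
    · exact ⟨1, one_pos, by simp [he]⟩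
    · obtain ⟨y, hy, hmin⟩ := hS.exists_isMinOn hne hc.continuousOn
      refine ⟨y ⬝ᵥ (H *ᵥ y), ?_, fun x hx => hmin hx⟩
      have hy0 : y ≠ 0 := by
        rintro rfl
        simp [S] at hy
      simpa using hH.dotProduct_mulVec_pos hy0
  obtain ⟨h, h0, hh⟩ := key
  refine ⟨h, h0, fun x => ?_⟩
  by_cases hx : x = 0
  · simp [hx]
  have hp : 0 < x ⬝ᵥ x := by
    have := dotProduct_star_self_pos_iff (v := x)
    simpa using this.2 hx
  have hs := Real.sq_sqrt hp.le
  have hs0 := Real.sqrt_pos.2 hp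
  set t := Real.sqrt (x ⬝ᵥ x)
  have := hh (t⁻¹ • x) (by
    simp only [S, Set.mem_setOf_eq, smul_dotProduct, dotProduct_smul, smul_eq_mul, ← hs]
    field_simp)
  simp only [mulVec_smul, smul_dotProduct, dotProduct_smul, smul_eq_mul] at this
  rw [← hs]
  have e : t⁻¹ * (t⁻¹ * x ⬝ᵥ (H *ᵥ x)) = x ⬝ᵥ (H *ᵥ x) / t ^ 2 := by
    field_simp
  rw [e, le_div_iff₀ (by positivity)] at this
  exact this

lemma aux_upper {n : ℕ} (R : Matrix (Fin n) (Fin n) ℝ) :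
    ∃ r : ℝ, 0 < r ∧ ∀ x : Fin n → ℝ, x ⬝ᵥ (R *ᵥ x) ≤ r * (x ⬝ᵥ x) := by
  refine ⟨1 + ∑ i, ∑ j, |R i j|, by positivity, fun x => ?_⟩
  have hsq : ∀ i, x i ^ 2 ≤ x ⬝ᵥ x := fun i => by
    rw [pow_two]
    exact Finset.single_le_sum (f := fun i => x i * x i) (fun i _ => mul_self_nonneg _)
          (Finset.mem_univ i)
  have hn : 0 ≤ x ⬝ᵥ x := Finset.sum_nonneg fun i _ => mul_self_nonneg _
  have : x ⬝ᵥ (R *ᵥ x) ≤ (∑ i, ∑ j, |R i j|) * (x ⬝ᵥ x) := by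
    have e0 : x ⬝ᵥ (R *ᵥ x) = ∑ i, ∑ j, x i * (R i j * x j) := by
      simp only [Matrix.mulVec, dotProduct, Finset.mul_sum]
    rw [e0]
    simp only [Finset.sum_mul]
    refine Finset.sum_le_sum fun i _ => Finset.sum_le_sum fun j _ => ?_
    have h3 : |x i * x j| ≤ x ⬝ᵥ x := by
      rw [abs_le]
      constructor <;> nlinarith [hsq i, hsq j, sq_nonneg (x i + x j), sq_nonneg (x i - x j)]
    calc x i * (R i j * x j) = R i j * (x i * x j) := by ring
      _ ≤ |R i j * (x i * x j)| := le_abs_self _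
      _ = |R i j| * |x i * x j| := abs_mul _ _
      _ ≤ |R i j| * (x ⬝ᵥ x) := by gcongr
  linarith

def auxK (e : ℝ) : Matrix (Fin 3) (Fin 6) ℝ :=
  !![-e^2, 0, 0, -(2*e), 0, 0; 0, -e^2, 0, 0, -(2*e), 0; 0, 0, -e^2, 0, 0, -(2*e)]

def auxP (s e : ℝ) : Matrix (Fin 6) (Fin 6) ℝ :=
  !![3*s*e^2, 0, 0, s*e, 0, 0; 0, 3*s*e^2, 0, 0, s*e, 0; 0, 0, 3*s*e^2, 0, 0, s*e;
     s*e, 0, 0, s, 0, 0; 0, s*e, 0, 0, s, 0; 0, 0, s*e, 0, 0, s]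

def auxC (e : ℝ) : Matrix (Fin 6) (Fin 6) ℝ :=
  !![0, 0, 0, 1, 0, 0; 0, 0, 0, 0, 1, 0; 0, 0, 0, 0, 0, 1;
    -e^2, 0, 0, -(2*e), 0, 0; 0, -e^2, 0, 0, -(2*e), 0; 0, 0, -e^2, 0, 0, -(2*e)]

lemma auxC_eq (e : ℝ) : matA + matB * auxK e = auxC e := by
  ext i j
  fin_cases i <;> fin_cases j <;>
    simp [matA, matB, auxK, auxC, Matrix.mul_apply, Fin.sum_univ_succ]

lemma auxP_symm (s e : ℝ) : (auxP s e)ᵀ = auxP s e := by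
  ext i j
  fin_cases i <;> fin_cases j <;> simp [auxP]

def zz (e : ℝ) (x : Fin 6 → ℝ) : ℝ :=
  e^2 * (x 0^2 + x 1^2 + x 2^2) + (x 3^2+x 4^2+x 5^2)

lemma zz_upper (e : ℝ) (h0 : 0 < e) (h1 : e ≤ 1) (x : Fin 6 → ℝ) : zz e x ≤ x ⬝ᵥ x := by
  have : e^2 ≤ 1 := by nlinarith
  have h : 0 ≤ x 0^2 + x 1^2 + x 2^2 := by positivity
  simp only [zz, dotProduct, Fin.sum_univ_six]
  nlinarith

lemma zz_lower (e : ℝ) (h0 : 0 < e) (h1 : e ≤ 1) (x : Fin 6 → ℝ) : e^2 * (x ⬝ᵥ x) ≤ zz e x := by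
  have : e^2 ≤ 1 := by nlinarith
  have h : 0 ≤ x 3^2 + x 4^2 + x 5^2 := by positivity
  simp only [zz, dotProduct, Fin.sum_univ_six]
  nlinarith

lemma auxP_form (s e : ℝ) (x : Fin 6 → ℝ) : x ⬝ᵥ (auxP s e *ᵥ x) =
    s * (3 * e^2 * (x 0^2 + x 1^2 + x 2^2) + 2 * e * (x 0 * x 3 + x 1 * x 4 + x 2 * x 5)
      + (x 3^2+x 4^2+x 5^2)) := by
  simp [auxP, dotProduct, Matrix.mulVec, Fin.sum_univ_succ]
  ring_nf!
  try rfl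

lemma auxK_form (e : ℝ) (x : Fin 6 → ℝ) : (auxK e *ᵥ x) ⬝ᵥ (auxK e *ᵥ x) =
    e^2 * ((e * x 0 + 2 * x 3)^2 + (e * x 1 + 2 * x 4)^2 + (e * x 2 + 2 * x 5)^2) := by
  simp [auxK, dotProduct, Matrix.mulVec, Fin.sum_univ_succ]
  ring_nf!
  try rfl

lemma auxC_form (s e : ℝ) (x : Fin 6 → ℝ) : (auxC e *ᵥ x) ⬝ᵥ (auxP s e *ᵥ x) =
    - (s * e * zz e x) := by
  simp [auxC, auxP, zz, dotProduct, Matrix.mulVec, Fin.sum_univ_succ]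
  ring_nf!
  try rfl

lemma auxP_le (s e : ℝ) (hs : 0 < s) (x : Fin 6 → ℝ) :
    x ⬝ᵥ (auxP s e *ᵥ x) ≤ s * (4 * zz e x) := by
  rw [auxP_form]
  gcongr
  simp only [zz]
  nlinarith [sq_nonneg (e * x 0 - x 3), sq_nonneg (e * x 1 - x 4), sq_nonneg (e * x 2 - x 5),
    sq_nonneg (x 3), sq_nonneg (x 4), sq_nonneg (x 5)]

lemma auxP_ge (s e : ℝ) (hs : 0 < s) (x : Fin 6 → ℝ) :
    s * (zz e x / 2) ≤ x ⬝ᵥ (auxP s e *ᵥ x) := by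
  rw [auxP_form]
  gcongr
  simp only [zz]
  nlinarith [sq_nonneg (2 * (e * x 0) + x 3), sq_nonneg (2 * (e * x 1) + x 4),
    sq_nonneg (2 * (e * x 2) + x 5), sq_nonneg (e * x 0), sq_nonneg (e * x 1),
    sq_nonneg (e * x 2)]

lemma auxK_le (e : ℝ) (x : Fin 6 → ℝ) :
    (auxK e *ᵥ x) ⬝ᵥ (auxK e *ᵥ x) ≤ e^2 * (5 * zz e x) := by
  rw [auxK_form]
  gcongr
  simp only [zz]
  nlinarith [sq_nonneg (2 * (e * x 0) - x 3), sq_nonneg (2 * (e * x 1) - x 4),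
    sq_nonneg (2 * (e * x 2) - x 5)]

theorem stmt15 (b lP lH : ℝ) (hb : 0 < b) (hlP : 0 < lP) (hlH : 0 < lH)
    (Rh : Matrix (Fin 3) (Fin 3) ℝ) (hRh : Rh.PosDef)
    (H : Matrix (Fin 6) (Fin 6) ℝ) (hH : H.PosDef) :
    ∃ (K : Matrix (Fin 3) (Fin 6) ℝ) (Qh P : Matrix (Fin 6) (Fin 6) ℝ),
      Qh.PosDef ∧ P.PosDef ∧
      -- (i)  (A + BK)ᵀP + P(A + BK) ≼ −Q̂ − KᵀR̂K
      ((-(Qh + Kᵀ * Rh * K)) -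
        ((matA + matB * K)ᵀ * P + P * (matA + matB * K))).PosSemidef ∧
      -- (ii) (1/ℓ_P)P ≼ (1/ℓ_H)H
      ((1 / lH) • H - (1 / lP) • P).PosSemidef ∧
      -- (iii) (1/b²)KᵀK ≼ (1/ℓ_P)P
      ((1 / lP) • P - (1 / b ^ 2) • (Kᵀ * K)).PosSemidef := by
  obtain ⟨h, h0, hh⟩ := aux_lower_s15 H hH
  obtain ⟨r, r0, hr⟩ := aux_upper Rh
  obtain ⟨s, hs, hs1⟩ : ∃ s : ℝ, 0 < s ∧ 1 / lP * (s * 4) = 1 / lH * h :=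
    ⟨lP * h / (4 * lH), by positivity, by field_simp⟩
  obtain ⟨e, he, he1, he2, he3⟩ : ∃ e : ℝ, 0 < e ∧ e ≤ 1 ∧ 5 * e * r ≤ s ∧
      1 / b^2 * (5 * e) ≤ 1 / lP * (s / 2) := by
    refine ⟨min 1 (min (s / (5 * r)) (b^2 * s / (10 * lP))), by positivity, min_le_left _ _, ?_, ?_⟩
    · have : min 1 (min (s / (5 * r)) (b^2 * s / (10 * lP))) ≤ s / (5 * r) :=
        (min_le_right _ _).trans (min_le_left _ _)
      rw [le_div_iff₀ (by positivity)] at this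
      linarith
    · have : min 1 (min (s / (5 * r)) (b^2 * s / (10 * lP))) ≤ b^2 * s / (10 * lP) :=
        (min_le_right _ _).trans (min_le_right _ _)
      calc _ ≤ 1 / b^2 * (5 * (b^2 * s / (10 * lP))) := by gcongr
        _ = _ := by field_simp; norm_num
  have hPs := auxP_symm s e
  have hHs : Hᵀ = H := by simpa [Matrix.IsHermitian] using hH.1
  have hRs : Rhᵀ = Rh := by simpa [Matrix.IsHermitian] using hRh.1
  have hz : ∀ x, 0 ≤ zz e x := fun x => by unfold zz; positivity
  refine ⟨auxK e, (s * e * e^2) • 1, auxP s e, ?_, ?_, ?_, ?_, ?_⟩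
  · exact Matrix.PosDef.one.smul (by positivity)
  · refine Matrix.PosDef.of_dotProduct_mulVec_pos ?_ fun x hx => ?_
    · simpa [Matrix.IsHermitian] using hPs
    have hp : 0 < x ⬝ᵥ x := by
      have := dotProduct_star_self_pos_iff (v := x)
      simpa using this.2 hx
    have h1 := auxP_ge s e hs x
    have h2 := zz_lower e he he1 x
    have h3 : 0 < e^2 * (x ⬝ᵥ x) := by positivity
    have h4 : 0 < s * (zz e x / 2) := mul_pos hs (by linarith)
    simpa using h4.trans_le h1
  · rw [auxC_eq]
    refine Matrix.PosSemidef.of_dotProduct_mulVec_nonneg ?_ fun x => ?_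
    · simp [Matrix.IsHermitian, Matrix.transpose_mul, hPs, hRs, Matrix.mul_assoc, add_comm]
    have h1 := auxC_form s e x
    have h2 := hr (auxK e *ᵥ x)
    have h3 := auxK_le e x
    have h4 := zz_lower e he he1 x
    have e1 : x ⬝ᵥ (((auxK e)ᵀ * Rh * auxK e) *ᵥ x) =
        (auxK e *ᵥ x) ⬝ᵥ (Rh *ᵥ (auxK e *ᵥ x)) := by
      rw [← mulVec_mulVec, ← mulVec_mulVec, dotProduct_mulVec, vecMul_transpose]
    have e2 : x ⬝ᵥ (((auxC e)ᵀ * auxP s e) *ᵥ x) = (auxC e *ᵥ x) ⬝ᵥ (auxP s e *ᵥ x) := by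
      rw [← mulVec_mulVec, dotProduct_mulVec, vecMul_transpose]
    have e3 : x ⬝ᵥ ((auxP s e * auxC e) *ᵥ x) = (auxC e *ᵥ x) ⬝ᵥ (auxP s e *ᵥ x) := by
      rw [← mulVec_mulVec, dotProduct_mulVec, dotProduct_comm]
      congr 1
      conv_lhs => rw [← hPs, vecMul_transpose]
    simp only [star_trivial, sub_mulVec, neg_mulVec, add_mulVec, dotProduct_sub, dotProduct_neg,
      dotProduct_add, e1, e2, e3, h1, smul_mulVec, one_mulVec, dotProduct_smul, smul_eq_mul]
    have h5 : s * e * (e^2 * (x ⬝ᵥ x)) ≤ s * e * zz e x := by gcongr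
    have h6 : r * ((auxK e *ᵥ x) ⬝ᵥ (auxK e *ᵥ x)) ≤ r * (e^2 * (5 * zz e x)) := by gcongr
    have h7 : (5 * e * r) * (e * zz e x) ≤ s * (e * zz e x) :=
      mul_le_mul_of_nonneg_right he2 (mul_nonneg he.le (hz x))
    linarith
  · refine Matrix.PosSemidef.of_dotProduct_mulVec_nonneg ?_ fun x => ?_
    · simp [Matrix.IsHermitian, hPs, hHs]
    simp only [star_trivial, sub_mulVec, dotProduct_sub, smul_mulVec, dotProduct_smul, smul_eq_mul]
    rw [sub_nonneg]
    calc _ ≤ 1 / lP * (s * (4 * zz e x)) := by gcongr; exact auxP_le s e hs x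
      _ ≤ 1 / lP * (s * (4 * (x ⬝ᵥ x))) := by gcongr; exact zz_upper e he he1 x
      _ = (1 / lP * (s * 4)) * (x ⬝ᵥ x) := by ring
      _ = 1 / lH * (h * (x ⬝ᵥ x)) := by rw [hs1]; ring
      _ ≤ _ := by gcongr; exact hh x
  · refine Matrix.PosSemidef.of_dotProduct_mulVec_nonneg ?_ fun x => ?_
    · simp [Matrix.IsHermitian, Matrix.transpose_mul, hPs]
    have e1 : x ⬝ᵥ (((auxK e)ᵀ * auxK e) *ᵥ x) = (auxK e *ᵥ x) ⬝ᵥ (auxK e *ᵥ x) := by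
      rw [← mulVec_mulVec, dotProduct_mulVec, vecMul_transpose]
    simp only [star_trivial, sub_mulVec, dotProduct_sub, smul_mulVec, dotProduct_smul, smul_eq_mul,
      e1]
    rw [sub_nonneg]
    have hee : e^2 ≤ e := by nlinarith
    have := hz x
    calc _ ≤ 1 / b^2 * (e^2 * (5 * zz e x)) := by gcongr; exact auxK_le e x
      _ ≤ 1 / b^2 * (e * (5 * zz e x)) := by gcongr
      _ = (1 / b^2 * (5 * e)) * zz e x := by ring
      _ ≤ (1 / lP * (s / 2)) * zz e x := by gcongr
      _ = 1 / lP * (s * (zz e x / 2)) := by ring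
      _ ≤ _ := by gcongr; exact auxP_ge s e hs x
end
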